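/- Let k be an algebraically closed field of characteristic neither 2 nor 3. There does not exist a local Artin Gorenstein k-algebra A with residue field k whose Hilbert function satisfies, for some integer s ≥ 4: H_A(0) = 1, H_A(1) = 4, H_A(2) = 3, H_A(3) = 4, H_A(i) = 1 for 4 ≤ i ≤ s, and H_A(i) = 0 for i > s. -/

import Mathlib

open MvPolynomial

noncomputable section

/-- The Hilbert function `H(l) = dim_k 𝔪^l/𝔪^(l+1)` of a local algebra `(A, 𝔪)`. -/
noncomputable def hilb (k : Type*) [CommRing k] {A : Type*} [CommRing A] [Algebra k A]
    (M : Ideal A) (l : ℕ) : ℕ :=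
  Module.finrank k
    (↥(Submodule.restrictScalars k (M ^ l)) ⧸
      (Submodule.comap (Submodule.restrictScalars k (M ^ l)).subtype
        (Submodule.restrictScalars k (M ^ (l + 1)))))

theorem exists_common_kernel {k V₁ V₂ V₃ : Type*} [Field k] (h2 : (2 : k) ≠ 0) (h3 : (3 : k) ≠ 0)
    [AddCommGroup V₁] [AddCommGroup V₂] [AddCommGroup V₃] [Module k V₁] [Module k V₂] [Module k V₃]
    [Module.Finite k V₁] [Module.Finite k V₂] [Module.Finite k V₃]
    (μ : V₁ →ₗ[k] V₁ →ₗ[k] V₂) (ν : V₁ →ₗ[k] V₂ →ₗ[k] V₃)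
    (hsymm : ∀ a b, μ a b = μ b a) (hcomm : ∀ a b c, ν a (μ b c) = ν b (μ a c))
    (hμ : ∀ P : Submodule k V₂, (∀ a b, μ a b ∈ P) → P = ⊤)
    (hν : ∀ P : Submodule k V₃, (∀ a v, ν a v ∈ P) → P = ⊤)
    (d₁ : Module.finrank k V₁ = 4) (d₂ : Module.finrank k V₂ = 3) (d₃ : Module.finrank k V₃ = 4) :
    ∃ N : Submodule k V₁, Module.finrank k N = 2 ∧ ∀ n ∈ N, ∀ a, μ n a = 0 := by
  -- no multiplication map `μ h` is surjective
  have hrank : ∀ h, LinearMap.range (μ h) ≠ ⊤ := by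
    intro h htop
    have : LinearMap.range (ν h) = ⊤ := by
      refine hν _ fun a v => ?_
      obtain ⟨b, rfl⟩ := LinearMap.range_eq_top.1 htop v
      exact ⟨μ a b, hcomm _ _ _⟩
    have h' := LinearMap.finrank_range_le (ν h)
    rw [this, finrank_top] at h'
    omega
  have polar : ∀ P : Submodule k V₂, (∀ a, μ a a ∈ P) → P = ⊤ := by
    intro P hP
    refine hμ P fun a b => ?_
    have h := P.sub_mem (P.sub_mem (hP (a + b)) (hP a)) (hP b)
    have e : μ (a + b) (a + b) - μ a a - μ b b = (2 : k) • μ a b := by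
      simp only [map_add, LinearMap.add_apply, hsymm b a]; module
    rw [e] at h
    exact (P.smul_mem_iff h2).1 h
  have small : ∀ v : V₂, Submodule.span k {v} ≠ ⊤ := by
    intro v hv
    have := finrank_span_le_card (R := k) ({v} : Set V₂)
    rw [hv, finrank_top] at this
    simp at this
    omega
  -- an element of rank two with nonzero square
  obtain ⟨h, u, hu⟩ : ∃ h u, LinearIndependent k ![μ h h, μ h u] := by
    obtain ⟨h, hh⟩ : ∃ h, μ h h ≠ 0 := by
      by_contra! hcon
      exact small 0 (polar _ fun a => by simp [hcon a])
    by_contra! hcon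
    have hspan : ∀ u, ∃ c : k, c • μ h h = μ h u := by
      intro u
      by_contra! hc
      exact hcon h u ((LinearIndependent.pair_iff' hh).2 hc)
    refine small (μ h h) (polar _ fun v => ?_)
    obtain ⟨c, hc⟩ := hspan v
    set n := v - c • h with hn
    have hhn : μ h n = 0 := by simp [hn, hc]
    have hnn : ∃ e : k, e • μ h h = μ n n := by
      by_contra! hc
      refine hcon (h + n) n ?_
      have hi := (LinearIndependent.pair_iff' hh).2 hc
      rw [LinearIndependent.pair_iff] at hi ⊢
      intro s t hst
      have := hi s (s + t) (by
        rw [← hst]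
        simp only [map_add, LinearMap.add_apply, hhn, hsymm n h]; module)
      obtain ⟨rfl, h'⟩ := this
      simpa using h'
    obtain ⟨e, he⟩ := hnn
    have hv : v = c • h + n := by simp [hn]
    rw [Submodule.mem_span_singleton]
    refine ⟨c * c + e, ?_⟩
    rw [hv]
    simp only [map_add, LinearMap.add_apply, map_smul, LinearMap.smul_apply, hhn, hsymm n h, ← he]
    module
  set P := Submodule.span k {μ h h, μ h u} with hP
  have hPle : P ≤ LinearMap.range (μ h) := by
    rw [hP, Submodule.span_le]
    rintro _ (rfl | rfl)
    exacts [⟨_, rfl⟩, ⟨_, rfl⟩]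
  have hPdim : Module.finrank k P = 2 := by
    have := finrank_span_eq_card hu
    rwa [Matrix.range_cons_cons_empty, Fintype.card_fin] at this
  have hrk : Module.finrank k (LinearMap.range (μ h)) = 2 := by
    have h1 := Submodule.finrank_mono hPle
    have h' := Submodule.finrank_lt (hrank h)
    omega
  have hPeq : P = LinearMap.range (μ h) :=
    Submodule.eq_of_le_of_finrank_eq hPle (by omega)
  -- the kernel of `μ h` is multiplied into `P`
  have key : ∀ g n, μ h n = 0 → μ g n ∈ P := by
    intro g n hn
    by_contra hgn
    have hb : P ⊔ Submodule.span k {μ g n} = ⊤ := by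
      apply Submodule.eq_top_of_finrank_eq
      have hlt : P < P ⊔ Submodule.span k {μ g n} := by
        refine lt_of_le_of_ne le_sup_left fun e => hgn ?_
        rw [e]
        exact Submodule.mem_sup_right (Submodule.mem_span_singleton_self _)
      have := Submodule.finrank_lt_finrank_of_lt hlt
      have := Submodule.finrank_le (P ⊔ Submodule.span k {μ g n})
      omega
    have coord : ∀ v : V₂, ∃ a b c : k, v = a • μ h h + b • μ h u + c • μ g n := by
      intro v
      have hv : v ∈ P ⊔ Submodule.span k {μ g n} := hb ▸ Submodule.mem_top
      obtain ⟨p, hp, q, hq, rfl⟩ := Submodule.mem_sup.1 hv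
      obtain ⟨a, b, rfl⟩ := Submodule.mem_span_pair.1 hp
      obtain ⟨c, rfl⟩ := Submodule.mem_span_singleton.1 hq
      exact ⟨a, b, c, rfl⟩
    obtain ⟨a₁, a₂, a₃, ha⟩ := coord (μ g h)
    obtain ⟨b₁, b₂, b₃, hb'⟩ := coord (μ g u)
    have hdet : ∀ t : k, t ≠ 0 → (1 + t * a₁) * (1 + t * b₂) - t * a₂ * (t * b₁) = 0 := by
      intro t ht
      by_contra hD
      set R := LinearMap.range (μ (h + t • g)) with hR
      have r0 : μ g n ∈ R := by
        refine (R.smul_mem_iff ht).1 ⟨n, ?_⟩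
        simp [hn]
      have r1 : (1 + t * a₁) • μ h h + (t * a₂) • μ h u ∈ R := by
        have : μ (h + t • g) h - (t * a₃) • μ g n ∈ R :=
          R.sub_mem ⟨h, rfl⟩ (R.smul_mem _ r0)
        convert this using 1
        simp only [map_add, LinearMap.add_apply, map_smul, LinearMap.smul_apply, ha]
        module
      have r2 : (t * b₁) • μ h h + (1 + t * b₂) • μ h u ∈ R := by
        have : μ (h + t • g) u - (t * b₃) • μ g n ∈ R :=
          R.sub_mem ⟨u, rfl⟩ (R.smul_mem _ r0)
        convert this using 1
        simp only [map_add, LinearMap.add_apply, map_smul, LinearMap.smul_apply, hb']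
        module
      have r3 : μ h h ∈ R := by
        refine (R.smul_mem_iff hD).1 ?_
        convert R.sub_mem (R.smul_mem (1 + t * b₂) r1) (R.smul_mem (t * a₂) r2) using 1
        module
      have r4 : μ h u ∈ R := by
        refine (R.smul_mem_iff hD).1 ?_
        convert R.sub_mem (R.smul_mem (1 + t * a₁) r2) (R.smul_mem (t * b₁) r1) using 1
        module
      refine hrank (h + t • g) (eq_top_iff.2 fun v _ => ?_)
      obtain ⟨a, b, c, rfl⟩ := coord v
      exact R.add_mem (R.add_mem (R.smul_mem _ r3) (R.smul_mem _ r4)) (R.smul_mem _ r0)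
    have e1 := hdet 1 one_ne_zero
    have e2 := hdet (-1) (neg_ne_zero.2 one_ne_zero)
    have e3 := hdet 2 h2
    have e4 : (2 : k) * 3 = 0 := by linear_combination (-2) * e3 + 6 * e1 + 2 * e2
    exact (mul_ne_zero h2 h3) e4
  set N := LinearMap.ker (μ h) with hN
  have hNdim : Module.finrank k N = 2 := by
    have := LinearMap.finrank_range_add_finrank_ker (μ h)
    rw [hrk, d₁] at this
    exact Nat.add_left_cancel (n := 2) this
  have decomp : ∀ v : V₁, ∃ a b : k, ∃ n, μ h n = 0 ∧ v = a • h + b • u + n := by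
    intro v
    have hv : μ h v ∈ P := hPeq ▸ ⟨v, rfl⟩
    obtain ⟨a, b, hab⟩ := Submodule.mem_span_pair.1 hv
    exact ⟨a, b, v - (a • h + b • u), by simp [hab], by abel⟩
  have hnP : ∀ n, μ h n = 0 → ∀ g, ∃ a b : k, a • μ h h + b • μ h u = μ n g := by
    intro n hn g
    rw [hsymm n g]
    exact Submodule.mem_span_pair.1 (key g n hn)
  have hV₂ : Submodule.span k {μ h h, μ h u, μ u u} = ⊤ := by
    set Q := Submodule.span k {μ h h, μ h u, μ u u} with hQ
    have q1 : μ h h ∈ Q := Submodule.subset_span (by simp)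
    have q2 : μ h u ∈ Q := Submodule.subset_span (by simp)
    have q3 : μ u u ∈ Q := Submodule.subset_span (by simp)
    refine polar Q fun v => ?_
    obtain ⟨a, b, n, hn, rfl⟩ := decomp v
    obtain ⟨c, d, h1⟩ := hnP n hn n
    obtain ⟨c', d', h1'⟩ := hnP n hn u
    have : μ (a • h + b • u + n) (a • h + b • u + n) =
        (a * a + c + 2 * b * c') • μ h h + (2 * a * b + d + 2 * b * d') • μ h u
          + (b * b) • μ u u := by
      simp only [map_add, LinearMap.add_apply, map_smul, LinearMap.smul_apply, hn, hsymm u h,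
        hsymm n h, hsymm u n, ← h1, ← h1']
      module
    rw [this]
    exact Q.add_mem (Q.add_mem (Q.smul_mem _ q1) (Q.smul_mem _ q2)) (Q.smul_mem _ q3)
  have hkill : ∀ n, μ h n = 0 → ∀ g, ν n (μ h g) = 0 := by
    intro n hn g
    rw [hsymm h g, hcomm, hsymm n h, hn, map_zero]
  set w : Fin 4 → V₃ := ![ν h (μ h h), ν h (μ h u), ν h (μ u u), ν u (μ u u)] with hw
  have hV₃ : Submodule.span k (Set.range w) = ⊤ := by
    set Q := Submodule.span k (Set.range w) with hQ
    have q1 : ν h (μ h h) ∈ Q := Submodule.subset_span ⟨0, rfl⟩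
    have q2 : ν h (μ h u) ∈ Q := Submodule.subset_span ⟨1, rfl⟩
    have q3 : ν h (μ u u) ∈ Q := Submodule.subset_span ⟨2, rfl⟩
    have q4 : ν u (μ u u) ∈ Q := Submodule.subset_span ⟨3, rfl⟩
    have q5 : ν u (μ h h) ∈ Q := by rw [hcomm, hsymm]; exact q2
    have q6 : ν u (μ h u) ∈ Q := by rw [hcomm]; exact q3
    refine hν Q fun a v => ?_
    have hv : v ∈ Submodule.span k {μ h h, μ h u, μ u u} := hV₂ ▸ Submodule.mem_top
    obtain ⟨x, y, z, rfl⟩ := Submodule.mem_span_triple.1 hv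
    obtain ⟨a, b, n, hn, rfl⟩ := decomp a
    have q7 : ν n (μ u u) ∈ Q := by
      rw [hcomm]
      obtain ⟨c, d, h1⟩ := hnP n hn u
      rw [← h1, map_add, map_smul, map_smul]
      exact Q.add_mem (Q.smul_mem _ q5) (Q.smul_mem _ q6)
    simp only [map_add, LinearMap.add_apply, map_smul, LinearMap.smul_apply, hkill n hn]
    refine Q.add_mem (Q.add_mem ?_ ?_) ?_ <;> refine Q.smul_mem _ (Q.add_mem (Q.add_mem ?_ ?_) ?_)
    all_goals first | exact Q.zero_mem | exact q7 | exact Q.smul_mem _ (by assumption)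
  have hindep : LinearIndependent k w :=
    linearIndependent_of_top_le_span_of_card_eq_finrank hV₃.ge (by simp [d₃])
  refine ⟨N, hNdim, fun n hn g => ?_⟩
  have hn : μ h n = 0 := hn
  obtain ⟨a, b, hab⟩ := hnP n hn g
  have hz : ν h (μ n g) = 0 := by rw [hcomm]; exact hkill n hn g
  rw [← hab, map_add, map_smul, map_smul] at hz
  have := Fintype.linearIndependent_iff.1 hindep ![a, b, 0, 0]
    (by simpa [Fin.sum_univ_four, hw] using hz)
  have ha : a = 0 := by simpa using this 0
  have hb : b = 0 := by simpa using this 1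
  rw [← hab, ha, hb]; simp

theorem exists_graded_projection {k A : Type*} [Field k] [AddCommGroup A] [Module k A]
    (P Q : Submodule k A) :
    ∃ (π : A →ₗ[k] (P ⧸ Q.comap P.subtype)) (σ : (P ⧸ Q.comap P.subtype) →ₗ[k] A),
      (∀ a ∈ P, π a = 0 ↔ a ∈ Q) ∧ (∀ v, σ v ∈ P) ∧ ∀ v, π (σ v) = v := by
  obtain ⟨π, hπ⟩ := LinearMap.exists_extend (Q.comap P.subtype).mkQ
  obtain ⟨τ, hτ⟩ := LinearMap.exists_rightInverse_of_surjective (Q.comap P.subtype).mkQ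
    (Submodule.range_mkQ _)
  have hπ' : ∀ p : P, π p = (Q.comap P.subtype).mkQ p := fun p => LinearMap.congr_fun hπ p
  refine ⟨π, P.subtype ∘ₗ τ, fun a ha => ?_, fun v => (τ v).2, fun v => ?_⟩
  · rw [hπ' ⟨a, ha⟩, ← LinearMap.mem_ker, Submodule.ker_mkQ]
    rfl
  · exact (hπ' (τ v)).trans (LinearMap.congr_fun hτ v)

theorem hilb_add_finrank {k A : Type*} [Field k] [CommRing A] [Algebra k A] [Module.Finite k A]
    (M : Ideal A) (i : ℕ) :
    hilb k M i + Module.finrank k ((M ^ (i + 1)).restrictScalars k) =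
      Module.finrank k ((M ^ i).restrictScalars k) := by
  have hle : (M ^ (i + 1)).restrictScalars k ≤ (M ^ i).restrictScalars k :=
    fun _ h => Ideal.pow_le_pow_right (Nat.le_succ i) h
  rw [← (Submodule.comapSubtypeEquivOfLe hle).finrank_eq]
  exact Submodule.finrank_quotient_add_finrank _

/-- Maximal growth of the Hilbert function from `3` to `4` forces two independent linear forms
that vanish on the degree one part of the associated graded algebra. -/
theorem exists_pair_mul_mem_cube {k A : Type*} [Field k] (c2 : (2 : k) ≠ 0) (c3 : (3 : k) ≠ 0)
    [CommRing A] [Algebra k A] [Module.Finite k A] (M : Ideal A)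
    (h1 : hilb k M 1 = 4) (h2 : hilb k M 2 = 3) (h3 : hilb k M 3 = 4) :
    ∃ n₁ n₂ : A, (∀ a b : k, a • n₁ + b • n₂ ∈ M ^ 2 → a = 0 ∧ b = 0) ∧
      (∀ m ∈ M, n₁ * m ∈ M ^ 3) ∧ ∀ m ∈ M, n₂ * m ∈ M ^ 3 := by
  obtain ⟨π₁, σ₁, k₁, m₁, r₁⟩ := exists_graded_projection
    ((M ^ 1).restrictScalars k) ((M ^ 2).restrictScalars k)
  obtain ⟨π₂, σ₂, k₂, m₂, r₂⟩ := exists_graded_projection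
    ((M ^ 2).restrictScalars k) ((M ^ 3).restrictScalars k)
  obtain ⟨π₃, σ₃, k₃, m₃, r₃⟩ := exists_graded_projection
    ((M ^ 3).restrictScalars k) ((M ^ 4).restrictScalars k)
  simp only [Submodule.restrictScalars_mem] at k₁ k₂ k₃ m₁ m₂ m₃
  have mulmem : ∀ {i j : ℕ} {a b : A}, a ∈ M ^ i → b ∈ M ^ j → a * b ∈ M ^ (i + j) := by
    intro i j a b ha hb
    rw [pow_add]
    exact Ideal.mul_mem_mul ha hb
  have res₁ : ∀ a ∈ M ^ 1, a - σ₁ (π₁ a) ∈ M ^ 2 := fun a ha =>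
    (k₁ _ (sub_mem ha (m₁ _))).1 (by rw [map_sub, r₁, sub_self])
  have res₂ : ∀ a ∈ M ^ 2, a - σ₂ (π₂ a) ∈ M ^ 3 := fun a ha =>
    (k₂ _ (sub_mem ha (m₂ _))).1 (by rw [map_sub, r₂, sub_self])
  have eq₂ : ∀ a b, a - b ∈ M ^ 3 → π₂ a = π₂ b := fun a b h => by
    have := (k₂ _ (Ideal.pow_le_pow_right (by norm_num) h)).2 h
    rwa [map_sub, sub_eq_zero] at this
  have eq₃ : ∀ a b, a - b ∈ M ^ 4 → π₃ a = π₃ b := fun a b h => by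
    have := (k₃ _ (Ideal.pow_le_pow_right (by norm_num) h)).2 h
    rwa [map_sub, sub_eq_zero] at this
  set μ := ((LinearMap.mul k A).compl₁₂ σ₁ σ₁).compr₂ π₂ with hμdef
  set ν := ((LinearMap.mul k A).compl₁₂ σ₁ σ₂).compr₂ π₃ with hνdef
  have hμ : ∀ a b, μ a b = π₂ (σ₁ a * σ₁ b) := fun a b => rfl
  have hν : ∀ a b, ν a b = π₃ (σ₁ a * σ₂ b) := fun a b => rfl
  have hνμ : ∀ a b c, ν a (μ b c) = π₃ (σ₁ a * (σ₁ b * σ₁ c)) := by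
    intro a b c
    rw [hν, hμ]
    refine (eq₃ _ _ ?_).symm
    rw [← mul_sub]
    exact mulmem (m₁ a) (res₂ _ (mulmem (m₁ b) (m₁ c)))
  obtain ⟨N, hN, hNμ⟩ := exists_common_kernel c2 c3 μ ν
    (fun a b => by rw [hμ, hμ, mul_comm])
    (fun a b c => by rw [hνμ, hνμ, mul_left_comm])
    (by
      intro P hP
      refine eq_top_iff.2 fun v _ => ?_
      have : ∀ x ∈ M ^ 1 * M ^ 1, π₂ x ∈ P := by
        intro x hx
        refine Submodule.mul_induction_on hx ?_ fun x y hx hy => ?_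
        · intro a ha b hb
          have := hP (π₁ a) (π₁ b)
          rw [hμ] at this
          rwa [eq₂ (a * b) (σ₁ (π₁ a) * σ₁ (π₁ b))]
          have e : a * b - σ₁ (π₁ a) * σ₁ (π₁ b) =
            (a - σ₁ (π₁ a)) * b + σ₁ (π₁ a) * (b - σ₁ (π₁ b)) := by ring
          rw [e]
          exact add_mem (mulmem (res₁ a ha) hb) (mulmem (m₁ _) (res₁ b hb))
        · rw [map_add]; exact P.add_mem hx hy
      rw [← r₂ v]
      exact this _ (by rw [← pow_add]; exact m₂ v))
    (by
      intro P hP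
      refine eq_top_iff.2 fun v _ => ?_
      have : ∀ x ∈ M ^ 1 * M ^ 2, π₃ x ∈ P := by
        intro x hx
        refine Submodule.mul_induction_on hx ?_ fun x y hx hy => ?_
        · intro a ha b hb
          have := hP (π₁ a) (π₂ b)
          rw [hν] at this
          rwa [eq₃ (a * b) (σ₁ (π₁ a) * σ₂ (π₂ b))]
          have e : a * b - σ₁ (π₁ a) * σ₂ (π₂ b) =
            (a - σ₁ (π₁ a)) * b + σ₁ (π₁ a) * (b - σ₂ (π₂ b)) := by ring
          rw [e]
          exact add_mem (mulmem (res₁ a ha) hb) (mulmem (m₁ _) (res₂ b hb))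
        · rw [map_add]; exact P.add_mem hx hy
      rw [← r₃ v]
      exact this _ (by rw [← pow_add]; exact m₃ v))
    h1 h2 h3
  have good : ∀ n ∈ N, ∀ m ∈ M, σ₁ n * m ∈ M ^ 3 := by
    intro n hn m hm
    rw [← pow_one M] at hm
    have h := hNμ n hn (π₁ m)
    rw [hμ] at h
    have h' := (k₂ _ (mulmem (m₁ n) (m₁ (π₁ m)))).1 h
    have e : σ₁ n * m = σ₁ n * σ₁ (π₁ m) + σ₁ n * (m - σ₁ (π₁ m)) := by ring
    rw [e]
    exact add_mem h' (mulmem (m₁ n) (res₁ m hm))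
  let B := Module.finBasisOfFinrankEq k N hN
  refine ⟨σ₁ (B 0), σ₁ (B 1), fun a b hab => ?_, good _ (B 0).2, good _ (B 1).2⟩
  have h := (k₁ (σ₁ (a • (B 0 : _) + b • (B 1 : _))) (m₁ _)).2 (by simpa using hab)
  rw [r₁] at h
  have h' : a • B 0 + b • B 1 = 0 := Subtype.ext (by simpa using h)
  have := Fintype.linearIndependent_iff.1 B.linearIndependent ![a, b]
    (by simpa [Fin.sum_univ_two] using h')
  exact ⟨by simpa using this 0, by simpa using this 1⟩

/-- Mutually annihilating subspaces of an algebra with a nondegenerate trace-like functional. -/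
theorem finrank_add_finrank_le_of_mul_eq_zero {k A : Type*} [Field k] [CommRing A] [Algebra k A]
    [Module.Finite k A] (φ : A →ₗ[k] k) (hφ : ∀ a, (∀ b, φ (a * b) = 0) → a = 0)
    (U W : Submodule k A) (h : ∀ u ∈ U, ∀ w ∈ W, u * w = 0) :
    Module.finrank k U + Module.finrank k W ≤ Module.finrank k A := by
  let f : A →ₗ[k] Module.Dual k A := (LinearMap.mul k A).compr₂ φ
  have hf : Function.Injective f := by
    rw [injective_iff_map_eq_zero]
    exact fun a ha => hφ a fun b => LinearMap.congr_fun ha b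
  have hle : U.map f ≤ W.dualAnnihilator := by
    rintro _ ⟨u, hu, rfl⟩
    rw [Submodule.mem_dualAnnihilator]
    intro w hw
    change φ (u * w) = 0
    rw [h u hu w hw, map_zero]
  have h1 := Submodule.finrank_mono hle
  rw [← (Submodule.equivMapOfInjective f hf U).finrank_eq] at h1
  have h2 := Subspace.finrank_add_finrank_dualAnnihilator_eq W
  omega

theorem le_sup_span_singleton {k A : Type*} [Field k] [AddCommGroup A] [Module k A]
    [Module.Finite k A] {P Q : Submodule k A} (hQP : Q ≤ P)
    (hd : Module.finrank k P ≤ Module.finrank k Q + 1) {g : A} (hg : g ∈ P) (hgQ : g ∉ Q) :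
    P ≤ Q ⊔ Submodule.span k {g} := by
  have hle : Q ⊔ Submodule.span k {g} ≤ P :=
    sup_le hQP ((Submodule.span_singleton_le_iff_mem _ _).2 hg)
  have hlt : Q < Q ⊔ Submodule.span k {g} :=
    lt_of_le_of_ne le_sup_left fun e => hgQ
      (e ▸ Submodule.mem_sup_right (Submodule.mem_span_singleton_self g))
  have := Submodule.finrank_lt_finrank_of_lt hlt
  exact (Submodule.eq_of_le_of_finrank_le hle (by omega)).ge

theorem pow_le_span_singleton {k A : Type*} [Field k] [CommRing A] [IsLocalRing A] [Algebra k A]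
    [Module.Finite k A] {i : ℕ} (hi : hilb k (IsLocalRing.maximalIdeal A) i = 1) {g : A}
    (hg : g ∈ IsLocalRing.maximalIdeal A ^ i) (hg' : g ∉ IsLocalRing.maximalIdeal A ^ (i + 1)) :
    IsLocalRing.maximalIdeal A ^ i ≤ Ideal.span {g} := by
  have : IsNoetherianRing A := IsNoetherianRing.of_finite k A
  have hd := hilb_add_finrank (k := k) (IsLocalRing.maximalIdeal A) i
  have h := le_sup_span_singleton (k := k)
    (P := (IsLocalRing.maximalIdeal A ^ i).restrictScalars k)
    (Q := (IsLocalRing.maximalIdeal A ^ (i + 1)).restrictScalars k)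
    (fun _ h => Ideal.pow_le_pow_right (Nat.le_succ i) h) (by omega) hg hg'
  refine Submodule.le_of_le_smul_of_le_jacobson_bot (IsNoetherian.noetherian _)
    (IsLocalRing.maximalIdeal_le_jacobson ⊥) fun a ha => ?_
  obtain ⟨b, hb, c, hc, rfl⟩ := Submodule.mem_sup.1 (h ha)
  obtain ⟨t, rfl⟩ := Submodule.mem_span_singleton.1 hc
  refine add_mem (Submodule.mem_sup_right ?_) (Submodule.mem_sup_left ?_)
  · rw [smul_eq_mul, ← pow_succ']; exact hb
  · rw [Algebra.smul_def]
    exact Ideal.mul_mem_left _ _ (Ideal.mem_span_singleton_self g)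

theorem pow_eq_pow_succ_of_hilb_eq_zero {k A : Type*} [Field k] [CommRing A] [Algebra k A]
    [Module.Finite k A] {M : Ideal A} {i : ℕ} (hi : hilb k M i = 0) : M ^ i = M ^ (i + 1) := by
  have hd := hilb_add_finrank (k := k) M i
  have hle : (M ^ (i + 1)).restrictScalars k ≤ (M ^ i).restrictScalars k :=
    fun _ h => Ideal.pow_le_pow_right (Nat.le_succ i) h
  have := Submodule.eq_of_le_of_finrank_eq hle (by omega)
  exact (Submodule.restrictScalars_injective k A A this).symm

theorem pow_eq_bot_of_hilb_eq_zero {k A : Type*} [Field k] [CommRing A] [IsLocalRing A]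
    [Algebra k A] [Module.Finite k A] {i : ℕ} (hi : hilb k (IsLocalRing.maximalIdeal A) i = 0) :
    IsLocalRing.maximalIdeal A ^ i = ⊥ := by
  have : IsNoetherianRing A := IsNoetherianRing.of_finite k A
  refine Submodule.eq_bot_of_le_smul_of_le_jacobson_bot (IsLocalRing.maximalIdeal A) _
    (IsNoetherian.noetherian _) ?_ (IsLocalRing.maximalIdeal_le_jacobson ⊥)
  rw [smul_eq_mul, ← pow_succ']
  exact (pow_eq_pow_succ_of_hilb_eq_zero hi).le

/-- A functional not vanishing on a simple socle is nondegenerate. -/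
theorem eq_zero_of_forall_apply_mul_eq_zero {k A : Type*} [Field k] [CommRing A] [Algebra k A]
    {M : Ideal A} {e : ℕ} (he : M ^ e = ⊥) {σ : A} (φ : A →ₗ[k] k) (hσ : φ σ ≠ 0)
    (hsoc : ∀ a, (∀ x ∈ M, x * a = 0) → ∃ c : k, c • σ = a) (a : A)
    (ha : ∀ b, φ (a * b) = 0) : a = 0 := by
  classical
  by_contra hne
  have hex : ∃ j, ∀ m ∈ M ^ j, a * m = 0 :=
    ⟨e, fun m hm => by rw [he, Submodule.mem_bot] at hm; rw [hm, mul_zero]⟩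
  obtain ⟨j, hj, hmin⟩ : ∃ j, (∀ m ∈ M ^ j, a * m = 0) ∧
      ∀ i < j, ¬ ∀ m ∈ M ^ i, a * m = 0 :=
    ⟨Nat.find hex, Nat.find_spec hex, fun i hi => Nat.find_min hex hi⟩
  cases j with
  | zero => exact hne (by simpa using hj 1 (by simp))
  | succ j =>
    have := hmin j (Nat.lt_succ_self j)
    push Not at this
    obtain ⟨m, hm, hm0⟩ := this
    obtain ⟨c, hc⟩ := hsoc (a * m) fun x hx => by
      rw [mul_left_comm]
      exact hj _ (by rw [pow_succ']; exact Ideal.mul_mem_mul hx hm)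
    have hφ := ha m
    rw [← hc, map_smul, smul_eq_mul] at hφ
    have hc0 := (mul_eq_zero.1 hφ).resolve_right hσ
    exact hm0 (by rw [← hc, hc0, zero_smul])

/-- (Lemma 5.4) Let `k` be an algebraically closed field of characteristic neither two
nor three.  There does not exist a local Artin Gorenstein `k`-algebra with residue field
`k` whose Hilbert function is `(1, 4, 3, 4, 1, …, 1)`, i.e. `H_A(0) = 1`, `H_A(1) = 4`,
`H_A(2) = 3`, `H_A(3) = 4`, `H_A(i) = 1` for `4 ≤ i ≤ s` and `H_A(i) = 0` for `i > s`,
for some `s ≥ 4`. -/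
theorem no_algebra_with_hilb_14341 {k : Type*} [Field k] [IsAlgClosed k]
    (hchar2 : ringChar k ≠ 2) (hchar3 : ringChar k ≠ 3)
    (A : Type*) [CommRing A] [IsLocalRing A] [Algebra k A] [Module.Finite k A]
    (hres : Function.Bijective ((IsLocalRing.residue A).comp (algebraMap k A)))
    (hGor : Module.finrank k
      ↥(⨅ x ∈ IsLocalRing.maximalIdeal A, LinearMap.ker (LinearMap.mulLeft k x)) = 1)
    (s : ℕ) (hs : 4 ≤ s)
    (h0 : hilb k (IsLocalRing.maximalIdeal A) 0 = 1)
    (h1 : hilb k (IsLocalRing.maximalIdeal A) 1 = 4)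
    (h2 : hilb k (IsLocalRing.maximalIdeal A) 2 = 3)
    (h3 : hilb k (IsLocalRing.maximalIdeal A) 3 = 4)
    (hmid : ∀ i, 4 ≤ i → i ≤ s → hilb k (IsLocalRing.maximalIdeal A) i = 1)
    (htop : ∀ i, s < i → hilb k (IsLocalRing.maximalIdeal A) i = 0) :
    False := by
  set M := IsLocalRing.maximalIdeal A with hM
  have c2 : (2 : k) ≠ 0 := by exact_mod_cast Ring.two_ne_zero hchar2
  have c3 : (3 : k) ≠ 0 := by
    intro h
    have hd : ringChar k ∣ 3 := ringChar.dvd (by exact_mod_cast h)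
    rcases (Nat.dvd_prime Nat.prime_three).1 hd with h' | h'
    · exact CharP.ringChar_ne_one h'
    · exact hchar3 h'
  obtain ⟨n₁, n₂, hind, hc₁, hc₂⟩ := exists_pair_mul_mem_cube c2 c3 M h1 h2 h3
  have mulmem : ∀ {i j : ℕ} {a b : A}, a ∈ M ^ i → b ∈ M ^ j → a * b ∈ M ^ (i + j) := by
    intro i j a b ha hb
    rw [pow_add]
    exact Ideal.mul_mem_mul ha hb
  have mulmem1 : ∀ {i : ℕ} {a b : A}, a ∈ M → b ∈ M ^ i → a * b ∈ M ^ (i + 1) := by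
    intro i a b ha hb
    rw [pow_succ']
    exact Ideal.mul_mem_mul ha hb
  -- the socle and a nondegenerate functional
  obtain ⟨⟨σ, hσ⟩, hσ0, hσ1⟩ := finrank_eq_one_iff'.1 hGor
  have hsoc : ∀ a, (∀ x ∈ M, x * a = 0) → ∃ c : k, c • σ = a := by
    intro a ha
    obtain ⟨c, hc⟩ := hσ1 ⟨a, by simpa [Submodule.mem_iInf] using ha⟩
    exact ⟨c, congrArg Subtype.val hc⟩
  obtain ⟨φ, hφ⟩ : ∃ φ : Module.Dual k A, φ σ ≠ 0 := by
    by_contra! hcon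
    exact hσ0 (Subtype.ext ((Module.forall_dual_apply_eq_zero_iff k σ).1 hcon))
  have hnd := eq_zero_of_forall_apply_mul_eq_zero
    (pow_eq_bot_of_hilb_eq_zero (htop (s + 1) (Nat.lt_succ_self s))) φ hφ hsoc
  have d0 := hilb_add_finrank (k := k) M 0
  have d1 := hilb_add_finrank (k := k) M 1
  have d3 := hilb_add_finrank (k := k) M 3
  have d4 := hilb_add_finrank (k := k) M 4
  rw [h0] at d0
  rw [h1] at d1
  rw [h3] at d3
  rw [hmid 4 le_rfl hs] at d4
  simp only [Nat.reduceAdd] at d0 d1 d3 d4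
  have hA : Module.finrank k ((M ^ 0).restrictScalars k) = Module.finrank k A := by
    rw [pow_zero, Ideal.one_eq_top, Submodule.restrictScalars_top, finrank_top]
  have count : ∀ (U : Submodule k A) (z : A), z ∉ M ^ 2 → 5 ≤ Module.finrank k U →
      (∀ u ∈ U, ∀ m ∈ M ^ 2, u * m = 0) → (∀ u ∈ U, u * z = 0) → False := by
    intro U z hz hU hUM hUz
    have hlt : (M ^ 2).restrictScalars k < (M ^ 2).restrictScalars k ⊔ Submodule.span k {z} :=
      lt_of_le_of_ne le_sup_left fun e => hz
        ((e ▸ Submodule.mem_sup_right (Submodule.mem_span_singleton_self z) :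
          z ∈ (M ^ 2).restrictScalars k))
    have h := Submodule.finrank_lt_finrank_of_lt hlt
    have h' := finrank_add_finrank_le_of_mul_eq_zero φ hnd U
      ((M ^ 2).restrictScalars k ⊔ Submodule.span k {z}) (by
        intro u hu w hw
        obtain ⟨b, hb, c, hc, rfl⟩ := Submodule.mem_sup.1 hw
        obtain ⟨t, rfl⟩ := Submodule.mem_span_singleton.1 hc
        rw [mul_add, hUM u hu b hb, mul_smul_comm, hUz u hu, smul_zero, add_zero])
    omega
  have mul5 : ∀ z, (∀ m ∈ M, z * m ∈ M ^ 3) → ∀ i, ∀ e ∈ M ^ (i + 1), z * e ∈ M ^ (i + 3) := by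
    intro z hz i e he
    rw [pow_succ'] at he
    refine Submodule.mul_induction_on he (fun a ha b hb => ?_) fun a b ha hb => ?_
    · rw [← mul_assoc, add_comm]; exact mulmem (hz a ha) hb
    · rw [mul_add]; exact add_mem ha hb
  rcases hs.eq_or_lt with rfl | hs5
  · have hM5 : M ^ 5 = ⊥ := pow_eq_bot_of_hilb_eq_zero (htop 5 (by norm_num))
    refine count ((M ^ 3).restrictScalars k) n₁ (fun h => ?_) (by omega)
      (fun u hu m hm => ?_) fun u hu => ?_
    · exact one_ne_zero (hind 1 0 (by simpa using h)).1
    · have := mulmem hu hm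
      rwa [hM5] at this
    · have := mul5 n₁ hc₁ 2 u hu
      rwa [hM5, mul_comm] at this
  have h5 := hmid 5 (by norm_num) hs5
  obtain ⟨x, hx, g, hg, hxg⟩ : ∃ x ∈ M, ∃ g ∈ M ^ 4, x * g ∉ M ^ 6 := by
    by_contra! hcon
    have hle : M ^ 5 ≤ M ^ 6 := by
      rw [pow_succ' M 4]
      exact Ideal.mul_le.2 hcon
    have d5 := hilb_add_finrank (k := k) M 5
    have := Submodule.finrank_mono (R := k) (s := (M ^ 5).restrictScalars k)
      (t := (M ^ 6).restrictScalars k) fun _ h => hle h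
    simp only [Nat.reduceAdd] at d5
    omega
  have hg5 : g ∉ M ^ 5 := fun h => hxg (mulmem1 hx h)
  have gen4 : ∀ a ∈ M ^ 4, ∃ u, u * g = a := fun a ha =>
    Ideal.mem_span_singleton'.1 (pow_le_span_singleton (hmid 4 le_rfl hs) hg hg5 ha)
  have gen5 : ∀ a ∈ M ^ 5, ∃ u, u * (x * g) = a := fun a ha =>
    Ideal.mem_span_singleton'.1 (pow_le_span_singleton h5 (mulmem1 hx hg) hxg ha)
  have gen6 : ∀ a ∈ M ^ 6, ∃ u, u * (x ^ 2 * g) = a := by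
    intro a ha
    rw [pow_succ'] at ha
    refine Submodule.mul_induction_on ha (fun a ha b hb => ?_) ?_
    · obtain ⟨u, rfl⟩ := gen5 b hb
      obtain ⟨v, hv⟩ := gen5 (a * g) (mulmem1 ha hg)
      exact ⟨u * v, by linear_combination (u * x) * hv⟩
    · rintro _ _ ⟨u, rfl⟩ ⟨v, rfl⟩
      exact ⟨u + v, add_mul _ _ _⟩
  have kill : ∀ y, y * g = 0 → ∀ e ∈ M ^ 4, y * e = 0 := by
    intro y hy e he
    obtain ⟨u, rfl⟩ := gen4 e he
    rw [mul_left_comm, hy, mul_zero]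
  have decomp : ∀ m ∈ M, ∃ u y, y * g = 0 ∧ m = u * x + y := by
    intro m hm
    obtain ⟨u, hu⟩ := gen5 (m * g) (mulmem1 hm hg)
    exact ⟨u, m - u * x, by linear_combination -hu, by ring⟩
  have adjust : ∀ n, (∀ m ∈ M, n * m ∈ M ^ 3) →
      ∃ z, n - z ∈ M ^ 2 ∧ z * g = 0 ∧ (∀ m ∈ M, z * m ∈ M ^ 3) ∧ ∃ c : k, c • σ = z * x ^ 3 := by
    intro n hnM
    obtain ⟨u, hu⟩ := gen6 (n * g) (mul5 n hnM 3 g hg)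
    have hx2 : u * x ^ 2 ∈ M ^ 2 := Ideal.mul_mem_left _ _ (Ideal.pow_mem_pow hx 2)
    have hzg : (n - u * x ^ 2) * g = 0 := by linear_combination -hu
    refine ⟨n - u * x ^ 2, by simpa using hx2, hzg, fun m hm => ?_, hsoc _ fun y hy => ?_⟩
    · rw [sub_mul]
      exact sub_mem (hnM m hm) (by rw [mul_comm]; exact mulmem1 hm hx2)
    · rw [mul_left_comm]
      exact kill _ hzg _ (mulmem1 hy (Ideal.pow_mem_pow hx 3))
  obtain ⟨z₁, hz₁, hg₁, hcz₁, t₁, ht₁⟩ := adjust n₁ hc₁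
  obtain ⟨z₂, hz₂, hg₂, hcz₂, t₂, ht₂⟩ := adjust n₂ hc₂
  obtain ⟨a, b, hab, habt⟩ : ∃ a b : k, ¬ (a = 0 ∧ b = 0) ∧ a * t₁ + b * t₂ = 0 := by
    by_cases ht : t₁ = 0
    · exact ⟨1, 0, by simp, by simp [ht]⟩
    · exact ⟨t₂, -t₁, by simp [ht], by ring⟩
  set z := a • z₁ + b • z₂ with hz
  have hzM2 : z ∉ M ^ 2 := by
    intro h
    refine hab (hind a b ?_)
    have e : a • n₁ + b • n₂ = z + (algebraMap k A a * (n₁ - z₁) + algebraMap k A b * (n₂ - z₂)) := by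
      simp only [hz, Algebra.smul_def]; ring
    rw [e]
    exact add_mem h (add_mem (Ideal.mul_mem_left _ _ hz₁) (Ideal.mul_mem_left _ _ hz₂))
  have hzM : ∀ m ∈ M, z * m ∈ M ^ 3 := by
    intro m hm
    rw [hz, add_mul, smul_mul_assoc, smul_mul_assoc, Algebra.smul_def, Algebra.smul_def]
    exact add_mem (Ideal.mul_mem_left _ _ (hcz₁ m hm)) (Ideal.mul_mem_left _ _ (hcz₂ m hm))
  have hzx : z * x ^ 3 = 0 := by
    rw [hz, add_mul, smul_mul_assoc, smul_mul_assoc, ← ht₁, ← ht₂, smul_smul, smul_smul,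
      ← add_smul, habt, zero_smul]
  clear_value z
  have yz : ∀ y, y * g = 0 → ∀ m ∈ M, ∀ m' ∈ M, y * (m' * (z * m)) = 0 := fun y hy m hm m' hm' =>
    kill y hy _ (mulmem1 hm' (hzM m hm))
  have hz3 : ∀ e ∈ M ^ 3, e * z = 0 := by
    intro e he
    rw [pow_succ'] at he
    refine Submodule.mul_induction_on he (fun m₁ hm₁ b hb => ?_) fun a b ha hb => ?_
    · rw [pow_two] at hb
      refine Submodule.mul_induction_on hb (fun m₂ hm₂ m₃ hm₃ => ?_) fun a b ha hb => ?_
      · obtain ⟨u₁, y₁, hy₁, e₁⟩ := decomp m₁ hm₁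
        obtain ⟨u₂, y₂, hy₂, e₂⟩ := decomp m₂ hm₂
        obtain ⟨u₃, y₃, hy₃, e₃⟩ := decomp m₃ hm₃
        have q₁ := yz y₁ hy₁ m₃ hm₃ m₂ hm₂
        have q₂ := yz y₂ hy₂ m₃ hm₃ x hx
        have q₃ := yz y₃ hy₃ x hx x hx
        calc m₁ * (m₂ * m₃) * z
            = u₁ * x * (m₂ * m₃) * z + y₁ * (m₂ * (z * m₃)) := by rw [e₁]; ring
          _ = u₁ * u₂ * (x * x * m₃ * z) + u₁ * (y₂ * (x * (z * m₃))) := by rw [q₁, e₂]; ring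
          _ = u₁ * u₂ * u₃ * (z * x ^ 3) + u₁ * u₂ * (y₃ * (x * (z * x))) := by
            rw [q₂, e₃]; ring
          _ = 0 := by rw [q₃, hzx]; ring
      · rw [mul_add, add_mul, ha, hb, add_zero]
    · rw [add_mul, ha, hb, add_zero]
  refine count ((M ^ 3).restrictScalars k ⊓ LinearMap.ker (LinearMap.mulLeft k (x ^ 2))) z hzM2 ?_
    ?_ fun u hu => hz3 u ((Submodule.restrictScalars_mem k _ _).1 hu.1)
  · let f := (LinearMap.mulLeft k (x ^ 2)).restrict (p := (M ^ 3).restrictScalars k)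
      (q := (M ^ 5).restrictScalars k) fun e he =>
        (Submodule.restrictScalars_mem k _ _).2 (mulmem (Ideal.pow_mem_pow hx 2) he)
    have hf := LinearMap.finrank_range_add_finrank_ker f
    have hf' := Submodule.finrank_le (LinearMap.range f)
    have hk : (LinearMap.ker f).map ((M ^ 3).restrictScalars k).subtype ≤
        (M ^ 3).restrictScalars k ⊓ LinearMap.ker (LinearMap.mulLeft k (x ^ 2)) := by
      rintro _ ⟨v, hv, rfl⟩
      exact ⟨v.2, congrArg Subtype.val (LinearMap.mem_ker.1 hv)⟩
    have hk' := Submodule.finrank_mono hk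
    rw [Submodule.finrank_map_subtype_eq] at hk'
    omega
  · rintro e ⟨he, hxe⟩ m hm
    have hxe : x ^ 2 * e = 0 := hxe
    rw [pow_two] at hm
    refine Submodule.mul_induction_on hm (fun m₁ hm₁ m₂ hm₂ => ?_) fun a b ha hb => ?_
    · obtain ⟨u₁, y₁, hy₁, e₁⟩ := decomp m₁ hm₁
      obtain ⟨u₂, y₂, hy₂, e₂⟩ := decomp m₂ hm₂
      have q₁ := kill y₁ hy₁ _ (mulmem1 hm₂ he)
      have q₂ := kill y₂ hy₂ _ (mulmem1 hx he)
      calc e * (m₁ * m₂) = u₁ * (x * m₂ * e) + y₁ * (m₂ * e) := by rw [e₁]; ring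
        _ = u₁ * u₂ * (x ^ 2 * e) + u₁ * (y₂ * (x * e)) := by rw [q₁, e₂]; ring
        _ = 0 := by rw [hxe, q₂]; ring
    · rw [mul_add, ha, hb, add_zero]
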